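/- arXiv:2512.22595 — 2 statements merged into one kernel-verified Lean document; each statement's English description precedes it below -/
import Mathlib

section
/- Let g ≥ 0 and let M be a G-perfect module of grade g over a commutative noetherian ring R, i.e., Gdim_R M = grade_R M = g. Then there is a natural isomorphism Ext^g_R(Ext^g_R(M,R), R) ≅ M. -/
open CategoryTheory IsLocalRing

noncomputable def ExtMod (R : Type) [CommRing R] (M N : Type) [AddCommGroup M] [Module R M]
    [AddCommGroup N] [Module R N] (i : ℕ) : ModuleCat R :=
  ((Ext R (ModuleCat.{0} R) i).obj (Opposite.op (ModuleCat.of R M))).obj (ModuleCat.of R N)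

noncomputable def mgrade (R : Type) [CommRing R] (M : Type) [AddCommGroup M] [Module R M] : ℕ :=
  sInf {i | Nontrivial (ExtMod R M R i)}

def IsTotallySelfDual (R : Type) [CommRing R] (M : Type) [AddCommGroup M] [Module R M] : Prop :=
  Nontrivial M ∧ Nonempty (ExtMod R M R (mgrade R M) ≃ₗ[R] M) ∧
    ∀ i, i ≠ mgrade R M → Subsingleton (ExtMod R M R i)

/-- A finitely generated module is totally reflexive if it is reflexive and
`Ext^i_R(M,R) = Ext^i_R(M*,R) = 0` for all `i > 0`. -/
def IsTotallyReflexive (R : Type) [CommRing R] (M : Type) [AddCommGroup M] [Module R M] : Prop :=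
  Module.Finite R M ∧ Function.Bijective (Module.Dual.eval R M) ∧
  (∀ i : ℕ, 0 < i → Subsingleton (ExtMod R M R i)) ∧
  (∀ i : ℕ, 0 < i → Subsingleton (ExtMod R (Module.Dual R M) R i))

/-- `GdimLE R n M` : `M` admits a resolution of length at most `n`
by totally reflexive modules. -/
def GdimLE (R : Type) [CommRing R] : ℕ → ModuleCat.{0} R → Prop
  | 0, M => IsTotallyReflexive R M
  | n+1, M => IsTotallyReflexive R M ∨ ∃ (G : ModuleCat.{0} R) (f : G →ₗ[R] M),
      IsTotallyReflexive R G ∧ Function.Surjective f ∧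
      GdimLE R n (ModuleCat.of R (LinearMap.ker f))

/-- The Gorenstein dimension of `M`. -/
noncomputable def Gdim (R : Type) [CommRing R] (M : Type) [AddCommGroup M] [Module R M] : ℕ∞ :=
  sInf {n : ℕ∞ | ∃ m : ℕ, n = (m : ℕ∞) ∧ GdimLE R m (ModuleCat.of R M)}

/-- `M` is G-perfect if it is nonzero and its Gorenstein dimension equals its grade. -/
def IsGPerfect (R : Type) [CommRing R] (M : Type) [AddCommGroup M] [Module R M] : Prop :=
  Nontrivial M ∧ Gdim R M = (mgrade R M : ℕ∞)

namespace CategoryTheory.ProjectiveResolution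

open Abelian CochainComplex HomComplex Limits

variable {C : Type*} [Category* C] [Abelian C]

theorem extMk_degree_zero_eq_zero_iff [HasExt C] {X Y : C} (P : ProjectiveResolution X)
    (f : P.complex.X 0 ⟶ Y) (m : ℕ) (hm : 0 + 1 = m) (hf : P.complex.d m 0 ≫ f = 0) :
    P.extMk f m hm hf = 0 ↔ f = 0 := by
  refine ⟨fun h ↦ ?_, fun h ↦ by subst h; simp⟩
  rw [← P.extEquivCohomologyClass.apply_eq_iff_eq, extEquivCohomologyClass_extMk,
    extEquivCohomologyClass_zero, CohomologyClass.mk_eq_zero_iff,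
    Cocycle.toSingleMk_mem_coboundaries_iff _ _ _ _ _ 1 (by simp)] at h
  obtain ⟨g, hg⟩ := h
  have hz : IsZero (P.cochainComplex.X 1) := P.cochainComplex.isZero_of_isStrictlyLE 0 1 (by simp)
  rw [hz.eq_of_src g 0, comp_zero] at hg
  rw [← cancel_epi (P.cochainComplexXIso (-(0 : ℕ)) 0 rfl).hom, ← hg, comp_zero]

variable (R : Type*) [CommRing R] [Linear R C] [HasExt C] {X Y : C}
  (P : ProjectiveResolution X)

/-- The map from `n`-cocycles of `Hom(P, Y)` to `Ext X Y n`. -/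
noncomputable def cocyclesToExt (Y : C) (n : ℕ) :
    LinearMap.ker (Linear.leftComp R Y (P.complex.d (n + 1) n)) →ₗ[R] Abelian.Ext X Y n where
  toFun f := P.extMk f.1 (n + 1) rfl f.2
  map_add' f g := (P.add_extMk f.1 g.1 (n + 1) rfl f.2 g.2).symm
  map_smul' r f := by
    have h := P.extMk_comp_mk₀ f.1 (n + 1) rfl f.2 (r • 𝟙 Y)
    rw [← Ext.smul_eq_comp_mk₀] at h
    simpa using h.symm

theorem cocyclesToExt_surjective (Y : C) (n : ℕ) :
    Function.Surjective (P.cocyclesToExt R Y n) := fun x ↦ by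
  obtain ⟨f, hf, rfl⟩ := P.extMk_surjective x (n + 1) rfl
  exact ⟨⟨f, hf⟩, rfl⟩

theorem nonempty_ext_linearEquiv [EnoughProjectives C] (P : ProjectiveResolution X) (Y : C)
    (n : ℕ) :
    Nonempty (((_root_.Ext R C n).obj (Opposite.op X)).obj Y ≃ₗ[R] Abelian.Ext X Y n) := by
  let K := ChainComplex.linearYonedaObj P.complex R Y
  obtain ⟨i, hi⟩ : ∃ i, (ComplexShape.up ℕ).prev n = i := ⟨_, rfl⟩
  let S := K.sc' i n (n + 1)
  let e := (P.isoExt (R := R) n Y ≪≫ K.homologyIsoSc' i n (n + 1) hi (by simp) ≪≫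
    S.moduleCatHomologyIso).toLinearEquiv
  let φ : LinearMap.ker S.g.hom →ₗ[R] Abelian.Ext X Y n := P.cocyclesToExt R Y n
  have hφ : Function.Surjective φ := P.cocyclesToExt_surjective R Y n
  have hker : LinearMap.range S.moduleCatToCycles = LinearMap.ker φ := by
    ext ⟨f, hf⟩
    rw [LinearMap.mem_ker]
    rcases n with _ | n
    · refine Iff.trans ?_ (P.extMk_degree_zero_eq_zero_iff f 1 rfl hf).symm
      have hd : S.f = 0 := K.shape i 0 (by simp [← hi])
      constructor
      · rintro ⟨x, hx⟩
        have h : S.f x = f := congrArg Subtype.val hx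
        rw [hd] at h
        exact h.symm
      · rintro rfl
        exact ⟨0, map_zero _⟩
    · refine Iff.trans ?_ (P.extMk_eq_zero_iff f (n + 2) rfl hf n rfl).symm
      obtain rfl : n = i := by simpa using hi
      constructor
      · rintro ⟨g, hg⟩
        exact ⟨g, congrArg Subtype.val hg⟩
      · rintro ⟨g, hg⟩
        exact ⟨g, Subtype.ext hg⟩
  exact ⟨e.trans ((Submodule.quotEquivOfEq _ _ hker).trans
    (φ.quotKerEquivOfSurjective hφ))⟩

end CategoryTheory.ProjectiveResolution

namespace ExtMod

variable {R : Type} [CommRing R]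

theorem nonempty_ext_linearEquiv (R : Type) [CommRing R] (M N : Type) [AddCommGroup M] [Module R M]
    [AddCommGroup N] [Module R N] (i : ℕ) :
    Nonempty (ExtMod R M N i ≃ₗ[R] Abelian.Ext (ModuleCat.of R M) (ModuleCat.of R N) i) :=
  ProjectiveResolution.nonempty_ext_linearEquiv R (projectiveResolution (ModuleCat.of R M)) _ i

theorem nonempty_congr {M M' : Type} [AddCommGroup M] [Module R M] [AddCommGroup M']
    [Module R M'] (e : M ≃ₗ[R] M') (N : Type) [AddCommGroup N] [Module R N] (i : ℕ) :
    Nonempty (ExtMod R M N i ≃ₗ[R] ExtMod R M' N i) :=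
  ⟨((((Ext R (ModuleCat.{0} R) i).mapIso e.toModuleIso.symm.op).app
    (ModuleCat.of R N))).toLinearEquiv⟩

theorem nonempty_zero_linearEquiv (R : Type) [CommRing R] (M N : Type) [AddCommGroup M]
    [Module R M] [AddCommGroup N] [Module R N] :
    Nonempty (ExtMod R M N 0 ≃ₗ[R] (M →ₗ[R] N)) := by
  obtain ⟨e⟩ := nonempty_ext_linearEquiv R M N 0
  exact ⟨e.trans (Abelian.Ext.linearEquiv₀.trans ModuleCat.homLinearEquiv)⟩

variable {A B C : Type} [AddCommGroup A] [Module R A] [AddCommGroup B] [Module R B]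
  [AddCommGroup C] [Module R C] {f : A →ₗ[R] B} {g : B →ₗ[R] C}

theorem exists_shortExact (hf : Function.Injective f) (hfg : Function.Exact f g)
    (hg : Function.Surjective g) :
    ∃ h : ModuleCat.ofHom f ≫ ModuleCat.ofHom g = 0,
      (ShortComplex.mk (ModuleCat.ofHom f) (ModuleCat.ofHom g) h).ShortExact :=
  ⟨by ext x; exact hfg.apply_apply_eq_zero x, ModuleCat.shortComplex_shortExact _ hfg hf hg⟩

theorem nonempty_dimension_shift (hf : Function.Injective f) (hfg : Function.Exact f g)
    (hg : Function.Surjective g) (N : Type) [AddCommGroup N] [Module R N] (i : ℕ)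
    (h₁ : Subsingleton (ExtMod R B N i)) (h₂ : Subsingleton (ExtMod R B N (i + 1))) :
    Nonempty (ExtMod R A N i ≃ₗ[R] ExtMod R C N (i + 1)) := by
  obtain ⟨w, hS⟩ := exists_shortExact hf hfg hg
  obtain ⟨eA⟩ := nonempty_ext_linearEquiv R A N i
  obtain ⟨eB⟩ := nonempty_ext_linearEquiv R B N i
  obtain ⟨eB'⟩ := nonempty_ext_linearEquiv R B N (i + 1)
  obtain ⟨eC⟩ := nonempty_ext_linearEquiv R C N (i + 1)
  have := eB.symm.injective.subsingleton
  have := eB'.symm.injective.subsingleton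
  let δ := hS.extClass.precompOfLinear R (ModuleCat.of R N) (add_comm 1 i)
  refine ⟨eA.trans ((LinearEquiv.ofBijective δ ⟨?_, fun x ↦ ?_⟩).trans eC.symm)⟩
  · rw [injective_iff_map_eq_zero]
    intro x hx
    obtain ⟨y, rfl⟩ := Abelian.Ext.contravariant_sequence_exact₁ hS _ x (add_comm 1 i) hx
    rw [Subsingleton.elim y 0, Abelian.Ext.comp_zero]
  · exact Abelian.Ext.contravariant_sequence_exact₃ hS _ x (Subsingleton.elim _ _) (add_comm 1 i)

theorem exists_connecting (hf : Function.Injective f) (hfg : Function.Exact f g)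
    (hg : Function.Surjective g) (N : Type) [AddCommGroup N] [Module R N]
    (h : Subsingleton (ExtMod R B N 1)) :
    ∃ δ : (A →ₗ[R] N) →ₗ[R] ExtMod R C N 1, Function.Surjective δ ∧
      ∀ φ, δ φ = 0 ↔ ∃ ψ : B →ₗ[R] N, ψ ∘ₗ f = φ := by
  obtain ⟨w, hS⟩ := exists_shortExact hf hfg hg
  obtain ⟨eB⟩ := nonempty_ext_linearEquiv R B N 1
  obtain ⟨eC⟩ := nonempty_ext_linearEquiv R C N 1
  have := eB.symm.injective.subsingleton
  let ε : (A →ₗ[R] N) ≃ₗ[R] Abelian.Ext (ModuleCat.of R A) (ModuleCat.of R N) 0 :=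
    (Abelian.Ext.linearEquiv₀.trans ModuleCat.homLinearEquiv).symm
  let δ := hS.extClass.precompOfLinear R (ModuleCat.of R N) (add_zero 1)
  refine ⟨eC.symm.toLinearMap ∘ₗ δ ∘ₗ ε.toLinearMap, ?_, fun φ ↦ ?_⟩
  · have hδ : Function.Surjective δ := fun x ↦
      Abelian.Ext.contravariant_sequence_exact₃ hS _ x (Subsingleton.elim _ _) (add_zero 1)
    exact eC.symm.surjective.comp (hδ.comp ε.surjective)
  · have hε : ε φ = Abelian.Ext.mk₀ (ModuleCat.ofHom φ) := rfl
    have hδ : (eC.symm.toLinearMap ∘ₗ δ ∘ₗ ε.toLinearMap) φ = 0 ↔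
        hS.extClass.comp (Abelian.Ext.mk₀ (ModuleCat.ofHom φ)) (add_zero 1) = 0 :=
      eC.symm.map_eq_zero_iff
    rw [hδ]
    constructor
    · intro h
      obtain ⟨y, hy⟩ := Abelian.Ext.contravariant_sequence_exact₁ hS _ _ _ h
      obtain ⟨ψ, rfl⟩ := (Abelian.Ext.homEquiv₀.symm).surjective y
      refine ⟨ψ.hom, ?_⟩
      have hy' : Abelian.Ext.mk₀ (ModuleCat.ofHom f ≫ ψ) =
          Abelian.Ext.mk₀ (ModuleCat.ofHom φ) := by
        rw [← hy, ← Abelian.Ext.mk₀_comp_mk₀]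
        rfl
      have := Abelian.Ext.homEquiv₀.symm.injective hy'
      exact congrArg ModuleCat.Hom.hom this
    · rintro ⟨ψ, rfl⟩
      rw [ModuleCat.ofHom_comp, ← Abelian.Ext.mk₀_comp_mk₀]
      exact hS.extClass_comp_assoc _

end ExtMod

section GorensteinDimension

open Module (Dual)

variable {R : Type} [CommRing R]

theorem LinearMap.exact_dualMap_dualMap {A B C : Type*} [AddCommGroup A] [Module R A]
    [AddCommGroup B] [Module R B] [AddCommGroup C] [Module R C] {f : A →ₗ[R] B} {g : B →ₗ[R] C}
    (h : Function.Exact f g) (hg : Function.Surjective g) :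
    Function.Exact g.dualMap f.dualMap :=
  LinearMap.exact_lcomp_of_exact_of_surjective R h hg

theorem IsTotallyReflexive.of_subsingleton (M : Type) [AddCommGroup M] [Module R M]
    [Subsingleton M] : IsTotallyReflexive R M := by
  have key (i : ℕ) (X : Type) [AddCommGroup X] [Module R X] [Subsingleton X] :
      Subsingleton (ExtMod R X R i) := by
    obtain ⟨e⟩ := ExtMod.nonempty_ext_linearEquiv R X R i
    have : Subsingleton (Abelian.Ext (ModuleCat.of R X) (ModuleCat.of R R) i) :=
      subsingleton_of_forall_eq 0 fun x ↦ by
        rw [← x.mk₀_id_comp, (ModuleCat.isZero_of_subsingleton (ModuleCat.of R X)).eq_of_src (𝟙 _) 0,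
          Abelian.Ext.mk₀_zero, Abelian.Ext.zero_comp]
    exact e.injective.subsingleton
  have : Subsingleton (Dual R M) := ⟨fun f g ↦ LinearMap.ext fun x ↦ by
    rw [Subsingleton.elim x 0, map_zero, map_zero]⟩
  have : Subsingleton (Dual R (Dual R M)) := ⟨fun f g ↦ LinearMap.ext fun x ↦ by
    rw [Subsingleton.elim x 0, map_zero, map_zero]⟩
  exact ⟨inferInstance, ⟨Function.injective_of_subsingleton _, fun y ↦ ⟨0, Subsingleton.elim _ _⟩⟩,
    fun i _ ↦ key i M, fun i _ ↦ key i _⟩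

theorem GdimLE.of_isTotallyReflexive {M : ModuleCat.{0} R} (h : IsTotallyReflexive R M) :
    ∀ n, GdimLE R n M
  | 0 => h
  | _ + 1 => Or.inl h

theorem GdimLE.exists_surjective {n : ℕ} {M : ModuleCat.{0} R} (h : GdimLE R (n + 1) M) :
    ∃ (G : ModuleCat.{0} R) (f : G →ₗ[R] M), IsTotallyReflexive R G ∧ Function.Surjective f ∧
      GdimLE R n (ModuleCat.of R (LinearMap.ker f)) := by
  refine h.elim (fun h ↦ ⟨M, LinearMap.id, h, Function.surjective_id, ?_⟩) id
  have : Subsingleton (LinearMap.ker (LinearMap.id : M →ₗ[R] M)) := by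
    rw [LinearMap.ker_id]; infer_instance
  exact .of_isTotallyReflexive (.of_subsingleton (LinearMap.ker (LinearMap.id : M →ₗ[R] M))) n

theorem gdimLE_of_Gdim_eq {M : Type} [AddCommGroup M] [Module R M] {n : ℕ}
    (h : Gdim R M = n) : GdimLE R n (ModuleCat.of R M) := by
  have hne : {n : ℕ∞ | ∃ m : ℕ, n = (m : ℕ∞) ∧ GdimLE R m (ModuleCat.of R M)}.Nonempty := by
    by_contra hne
    rw [Set.not_nonempty_iff_eq_empty] at hne
    rw [Gdim, hne, sInf_empty] at h
    exact ENat.top_ne_natCast n h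
  obtain ⟨m, hm, hM⟩ := csInf_mem hne
  have : m = n := by exact_mod_cast hm.symm.trans h
  exact this ▸ hM

theorem subsingleton_extMod_of_lt_mgrade {M : Type} [AddCommGroup M] [Module R M] {i : ℕ}
    (h : i < mgrade R M) : Subsingleton (ExtMod R M R i) :=
  not_nontrivial_iff_subsingleton.mp (Nat.notMem_of_lt_sInf h)

/-- `Ext^{n+1}(N, R)` is the cokernel of `M → M**`, and `Ext^{n+1+i}(N, R) ≅ Ext^i(M*, R)` for
`i > 0`. -/
def IsDualSyzygy (R : Type) [CommRing R] (n : ℕ) (M N : Type) [AddCommGroup M] [Module R M]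
    [AddCommGroup N] [Module R N] : Prop :=
  (∃ δ : Dual R (Dual R M) →ₗ[R] ExtMod R N R (n + 1), Function.Surjective δ ∧
    ∀ φ, δ φ = 0 ↔ ∃ x, Dual.eval R M x = φ) ∧
  ∀ i, 0 < i → Nonempty (ExtMod R (Dual R M) R i ≃ₗ[R] ExtMod R N R (n + 1 + i))

variable {G M : Type} [AddCommGroup G] [Module R G] [AddCommGroup M] [Module R M]

theorem IsDualSyzygy.of_exact {B N : Type} [AddCommGroup B]
    [Module R B] [AddCommGroup N] [Module R N] {n : ℕ} (hG : IsTotallyReflexive R G)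
    {f : G →ₗ[R] M} (hf : Function.Surjective f) {p : Dual R G →ₗ[R] B}
    (hfp : Function.Exact f.dualMap p) (hp : Function.Surjective p)
    (h : ∀ i, 0 < i → Nonempty (ExtMod R B R i ≃ₗ[R] ExtMod R N R (n + i))) :
    IsDualSyzygy R n M N := by
  have hf' := LinearMap.dualMap_injective_of_surjective hf
  refine ⟨?_, fun i hi ↦ ?_⟩
  · obtain ⟨δ, hδ, hδ'⟩ := ExtMod.exists_connecting hf' hfp hp R (hG.2.2.2 1 one_pos)
    obtain ⟨e⟩ := h 1 one_pos
    refine ⟨e.toLinearMap ∘ₗ δ, e.surjective.comp hδ, fun φ ↦ ?_⟩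
    refine e.map_eq_zero_iff.trans ((hδ' φ).trans ⟨?_, ?_⟩)
    · rintro ⟨ψ, rfl⟩
      obtain ⟨x, rfl⟩ := hG.2.1.2 ψ
      exact ⟨f x, rfl⟩
    · rintro ⟨y, rfl⟩
      obtain ⟨x, rfl⟩ := hf y
      exact ⟨Dual.eval R G x, rfl⟩
  · obtain ⟨e⟩ := ExtMod.nonempty_dimension_shift hf' hfp hp R i (hG.2.2.2 i hi)
      (hG.2.2.2 (i + 1) i.succ_pos)
    obtain ⟨e'⟩ := h (i + 1) i.succ_pos
    rw [add_assoc, add_comm 1 i]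
    exact ⟨e.trans e'⟩

theorem dualMap_subtype_surjective {f : G →ₗ[R] M} (hG : IsTotallyReflexive R G)
    (hf : Function.Surjective f) (h : Subsingleton (ExtMod R M R 1)) :
    Function.Surjective (LinearMap.ker f).subtype.dualMap := fun φ ↦ by
  obtain ⟨δ, -, hδ⟩ := ExtMod.exists_connecting (LinearMap.ker f).injective_subtype
    f.exact_subtype_ker_map hf R (hG.2.2.1 1 one_pos)
  exact (hδ φ).1 (Subsingleton.elim _ _)

theorem nonempty_extMod_ker_linearEquiv {f : G →ₗ[R] M} (hG : IsTotallyReflexive R G)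
    (hf : Function.Surjective f) {i : ℕ} (hi : 0 < i) :
    Nonempty (ExtMod R (LinearMap.ker f) R i ≃ₗ[R] ExtMod R M R (i + 1)) :=
  ExtMod.nonempty_dimension_shift (LinearMap.ker f).injective_subtype
    f.exact_subtype_ker_map hf R i (hG.2.2.1 i hi) (hG.2.2.1 (i + 1) i.succ_pos)

theorem GdimLE.isDualSyzygy (n : ℕ) : ∀ M : ModuleCat.{0} R, GdimLE R (n + 1) M →
    (∀ i, 0 < i → i ≤ n → Subsingleton (ExtMod R M R i)) →
    IsDualSyzygy R (n + 1) M (ExtMod R M R (n + 1)) := by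
  induction n with
  | zero =>
    intro M hM _
    obtain ⟨G, f, hG, hf, hK⟩ := hM.exists_surjective
    let r := (LinearMap.ker f).subtype.dualMap
    have hex : Function.Exact f.dualMap r :=
      LinearMap.exact_dualMap_dualMap f.exact_subtype_ker_map hf
    obtain ⟨δ, hδ, hδ'⟩ := ExtMod.exists_connecting (LinearMap.ker f).injective_subtype
      f.exact_subtype_ker_map hf R (hG.2.2.1 1 one_pos)
    have hex' : Function.Exact f.dualMap r.rangeRestrict := fun φ ↦ by
      rw [← hex φ, ← Subtype.coe_inj]
      rfl
    refine .of_exact (B := LinearMap.range r) hG hf hex' r.surjective_rangeRestrict fun i hi ↦ ?_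
    · rw [zero_add, add_comm 1 i]
      exact ExtMod.nonempty_dimension_shift (LinearMap.range r).injective_subtype
        (fun φ ↦ (hδ' φ).trans ⟨fun h ↦ ⟨⟨φ, h⟩, rfl⟩, by rintro ⟨φ, rfl⟩; exact φ.2⟩) hδ R i
        (hK.2.2.2 i hi) (hK.2.2.2 (i + 1) i.succ_pos)
  | succ n ih =>
    intro M hM hv
    obtain ⟨G, f, hG, hf, hK⟩ := hM.exists_surjective
    have hr := dualMap_subtype_surjective hG hf (hv 1 one_pos (by lia))
    refine .of_exact hG hf (LinearMap.exact_dualMap_dualMap f.exact_subtype_ker_map hf) hr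
      fun i hi ↦ ?_
    have hv' (i : ℕ) (hi : 0 < i) (hin : i ≤ n) :
        Subsingleton (ExtMod R (LinearMap.ker f) R i) := by
      obtain ⟨e⟩ := nonempty_extMod_ker_linearEquiv hG hf hi
      have := hv (i + 1) i.succ_pos (by lia)
      exact e.injective.subsingleton
    obtain ⟨e⟩ := (ih _ hK hv').2 i hi
    obtain ⟨e'⟩ := nonempty_extMod_ker_linearEquiv hG hf n.succ_pos
    obtain ⟨e''⟩ := ExtMod.nonempty_congr e' R (n + 1 + 1 + i)
    exact ⟨e.trans e''⟩

theorem nonempty_linearEquiv_of_bidual {E : Type} [AddCommGroup E] [Module R E]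
    {f : G →ₗ[R] M} (hG : IsTotallyReflexive R G) (hf : Function.Surjective f)
    (δ : Dual R (Dual R G) →ₗ[R] E) (hδ : Function.Surjective δ)
    (h : ∀ φ, δ φ = 0 ↔ ∃ x ∈ LinearMap.ker f, Dual.eval R G x = φ) : Nonempty (E ≃ₗ[R] M) := by
  let q : G →ₗ[R] E := δ ∘ₗ Dual.eval R G
  have hq : Function.Surjective q := hδ.comp hG.2.1.2
  have hk : LinearMap.ker q = LinearMap.ker f := by
    ext x
    refine (h _).trans ⟨?_, fun hx ↦ ⟨x, hx, rfl⟩⟩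
    rintro ⟨y, hy, hxy⟩
    exact hG.2.1.1 hxy ▸ hy
  exact ⟨(q.quotKerEquivOfSurjective hq).symm.trans
    ((Submodule.quotEquivOfEq _ _ hk).trans (f.quotKerEquivOfSurjective hf))⟩

theorem GdimLE.nonempty_extMod_extMod_linearEquiv {M : ModuleCat.{0} R} {n : ℕ}
    (hM : GdimLE R n M) (hv : ∀ i < n, Subsingleton (ExtMod R M R i)) :
    Nonempty (ExtMod R (ExtMod R M R n) R n ≃ₗ[R] M) := by
  rcases n with _ | n
  · obtain ⟨e⟩ := ExtMod.nonempty_zero_linearEquiv R M R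
    obtain ⟨e₁⟩ := ExtMod.nonempty_congr e R 0
    obtain ⟨e₂⟩ := ExtMod.nonempty_zero_linearEquiv R (Dual R M) R
    exact ⟨(e₁.trans e₂).trans (LinearEquiv.ofBijective (Dual.eval R M) hM.2.1).symm⟩
  obtain ⟨G, f, hG, hf, hK⟩ := hM.exists_surjective
  have : Subsingleton (Dual R M) := by
    obtain ⟨e⟩ := ExtMod.nonempty_zero_linearEquiv R M R
    have := hv 0 n.succ_pos
    exact e.symm.injective.subsingleton
  let r := (LinearMap.ker f).subtype.dualMap
  have hr : Function.Injective r := by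
    have hex : Function.Exact f.dualMap r :=
      LinearMap.exact_dualMap_dualMap f.exact_subtype_ker_map hf
    refine (injective_iff_map_eq_zero r).2 fun φ hφ ↦ ?_
    obtain ⟨ψ, rfl⟩ := (hex φ).1 hφ
    rw [Subsingleton.elim ψ 0, map_zero]
  rcases n with _ | n
  · obtain ⟨δ, hδ, hδ'⟩ := ExtMod.exists_connecting (LinearMap.ker f).injective_subtype
      f.exact_subtype_ker_map hf R (hG.2.2.1 1 one_pos)
    obtain ⟨ε, hε, hε'⟩ := ExtMod.exists_connecting hr hδ' hδ R (hK.2.2.2 1 one_pos)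
    refine nonempty_linearEquiv_of_bidual hG hf ε hε fun φ ↦ (hε' φ).trans ⟨?_, ?_⟩
    · rintro ⟨ψ, rfl⟩
      obtain ⟨x, rfl⟩ := hK.2.1.2 ψ
      exact ⟨x.1, x.2, rfl⟩
    · rintro ⟨x, hx, rfl⟩
      exact ⟨Dual.eval R _ ⟨x, hx⟩, rfl⟩
  · let e := LinearEquiv.ofBijective r
      ⟨hr, dualMap_subtype_surjective hG hf (hv 1 (by lia))⟩
    have he (ψ : Dual R G) (x : LinearMap.ker f) : e ψ x = ψ x := rfl
    have hv' (i : ℕ) (hi : 0 < i) (hin : i ≤ n) :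
        Subsingleton (ExtMod R (LinearMap.ker f) R i) := by
      obtain ⟨e⟩ := nonempty_extMod_ker_linearEquiv hG hf hi
      have := hv (i + 1) (by lia)
      exact e.injective.subsingleton
    obtain ⟨δ, hδ, hδ'⟩ := (hK.isDualSyzygy n _ hv').1
    obtain ⟨e₁⟩ := nonempty_extMod_ker_linearEquiv hG hf n.succ_pos
    obtain ⟨e₂⟩ := ExtMod.nonempty_congr e₁ R (n + 1 + 1)
    refine nonempty_linearEquiv_of_bidual hG hf
      (e₂.toLinearMap ∘ₗ δ ∘ₗ e.symm.dualMap.toLinearMap)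
      (e₂.surjective.comp (hδ.comp e.symm.dualMap.surjective)) fun φ ↦ ?_
    refine e₂.map_eq_zero_iff.trans ((hδ' _).trans ⟨?_, ?_⟩)
    · rintro ⟨x, hx⟩
      refine ⟨x.1, x.2, LinearMap.ext fun ψ ↦ ?_⟩
      simpa [he] using LinearMap.congr_fun hx (e ψ)
    · rintro ⟨x, hx, rfl⟩
      refine ⟨⟨x, hx⟩, LinearMap.ext fun ψ ↦ ?_⟩
      obtain ⟨ψ, rfl⟩ := e.surjective ψ
      simp [he]

end GorensteinDimension

/-- For a G-perfect module `M` of grade `g`, `Ext^g_R(Ext^g_R(M,R),R) ≅ M`. -/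
theorem stmt_9 (R : Type) [CommRing R] [IsNoetherianRing R]
    (M : Type) [AddCommGroup M] [Module R M] [Module.Finite R M]
    (g : ℕ) (hg : mgrade R M = g) (hGP : IsGPerfect R M) :
    Nonempty (ExtMod R (ExtMod R M R g) R g ≃ₗ[R] M) := by
  subst hg
  exact (gdimLE_of_Gdim_eq hGP.2).nonempty_extMod_extMod_linearEquiv
    fun i hi ↦ subsingleton_extMod_of_lt_mgrade hi
end

section
/- Let M be a nonzero finitely generated module of grade g over a commutative noetherian ring R. Then M is totally self-dual if and only if M is G-perfect and Ext^g_R(M,R) ≅ M. -/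
open CategoryTheory IsLocalRing

/-- Vanishing of `Ext^i(M, R)` can be checked on a projective resolution. -/
theorem subsingleton_extMod_iff_exactAt (R : Type) [CommRing R] (M N : Type) [AddCommGroup M]
    [Module R M] [AddCommGroup N] [Module R N] (P : ProjectiveResolution (ModuleCat.of R M))
    (i : ℕ) : Subsingleton (ExtMod R M N i) ↔
      (P.complex.linearYonedaObj R (ModuleCat.of R N)).ExactAt i := by
  rw [HomologicalComplex.exactAt_iff_isZero_homology,
    ← (P.isoExt i (ModuleCat.of R N) : _ ≅ _).isZero_iff, ModuleCat.isZero_iff_subsingleton]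
  rfl

theorem subsingleton_extMod_succ_iff (R : Type) [CommRing R] (M N : Type) [AddCommGroup M]
    [Module R M] [AddCommGroup N] [Module R N] (i : ℕ) :
    Subsingleton (ExtMod R M N (i + 1)) ↔
      Subsingleton (Abelian.Ext (ModuleCat.of R M) (ModuleCat.of R N) (i + 1)) := by
  let P := ProjectiveResolution.of (ModuleCat.of R M)
  rw [subsingleton_extMod_iff_exactAt R M N P,
    HomologicalComplex.exactAt_iff' _ i (i + 1) (i + 2) (by simp) (by simp),
    ShortComplex.moduleCat_exact_iff]
  constructor
  · refine fun h => ⟨fun a b => ?_⟩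
    rw [← sub_eq_zero]
    generalize a - b = x
    obtain ⟨f, hf, rfl⟩ := P.extMk_surjective x (i + 2) rfl
    rw [P.extMk_eq_zero_iff f (i + 2) rfl hf i rfl]
    exact h f hf
  · intro h f hf
    exact (P.extMk_eq_zero_iff f (i + 2) rfl hf i rfl).mp (Subsingleton.elim _ _)

/-- The functor `Ext^i(-, N)` vanishes at `M`. -/
def ExtVanishes (R : Type) [CommRing R] (i : ℕ) (M : Type) [AddCommGroup M] [Module R M] : Prop :=
  Subsingleton (Abelian.Ext (ModuleCat.of R M) (ModuleCat.of R R) i)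

theorem subsingleton_extMod_iff_extVanishes (R : Type) [CommRing R] (M : Type) [AddCommGroup M]
    [Module R M] (i : ℕ) (hi : 0 < i) : Subsingleton (ExtMod R M R i) ↔ ExtVanishes R i M := by
  obtain ⟨j, rfl⟩ := Nat.exists_eq_succ_of_ne_zero hi.ne'
  exact subsingleton_extMod_succ_iff R M R j

section

variable {R : Type} [CommRing R] {A B C : Type} [AddCommGroup A] [Module R A]
  [AddCommGroup B] [Module R B] [AddCommGroup C] [Module R C]

theorem ExtVanishes.of_equiv {i : ℕ} (h : ExtVanishes R i A) (e : A ≃ₗ[R] B) :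
    ExtVanishes R i B := by
  have : Subsingleton (Abelian.Ext (ModuleCat.of R A) (ModuleCat.of R R) i) := h
  refine ⟨fun a b => ?_⟩
  have key (x : Abelian.Ext (ModuleCat.of R B) (ModuleCat.of R R) i) : x = 0 := by
    have h1 : (Abelian.Ext.mk₀ e.toModuleIso.hom).comp x (zero_add i) = 0 :=
      Subsingleton.elim (α := Abelian.Ext (ModuleCat.of R A) (ModuleCat.of R R) i) _ _
    rw [← Abelian.Ext.mk₀_id_comp x, ← e.toModuleIso.inv_hom_id, ← Abelian.Ext.mk₀_comp_mk₀,
      Abelian.Ext.comp_assoc_of_second_deg_zero, h1, Abelian.Ext.comp_zero]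
  rw [key a, key b]

theorem extVanishes_of_projective [Module.Projective R A] {i : ℕ} (hi : 0 < i) :
    ExtVanishes R i A := by
  obtain ⟨j, rfl⟩ := Nat.exists_eq_succ_of_ne_zero hi.ne'
  have : Projective (ModuleCat.of R A) := (IsProjective.iff_projective A).1 inferInstance
  exact Abelian.Ext.subsingleton_of_projective _ _ _

theorem shortExact_of_exact {f : A →ₗ[R] B} {g : B →ₗ[R] C} (hf : Function.Injective f)
    (hfg : Function.Exact f g) (hg : Function.Surjective g) :
    (ShortComplex.mk (ModuleCat.ofHom f) (ModuleCat.ofHom g)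
      (by ext x; exact hfg.apply_apply_eq_zero x)).ShortExact where
  exact := by
    rw [ShortComplex.moduleCat_exact_iff]
    intro x hx
    exact (hfg x).1 hx
  mono_f := (ModuleCat.mono_iff_injective _).2 hf
  epi_g := (ModuleCat.epi_iff_surjective _).2 hg

theorem ExtVanishes.right_of_exact {f : A →ₗ[R] B} {g : B →ₗ[R] C} (hf : Function.Injective f)
    (hfg : Function.Exact f g) (hg : Function.Surjective g) {i : ℕ}
    (hA : ExtVanishes R i A) (hB : ExtVanishes R (i + 1) B) : ExtVanishes R (i + 1) C := by
  have hS := shortExact_of_exact hf hfg hg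
  have key (x : Abelian.Ext (ModuleCat.of R C) (ModuleCat.of R R) (i + 1)) : x = 0 := by
    obtain ⟨y, rfl⟩ := Abelian.Ext.contravariant_sequence_exact₃ hS (ModuleCat.of R R) x
      (hB.elim _ _) (add_comm 1 i)
    rw [show y = 0 from hA.elim _ _, Abelian.Ext.comp_zero]
  exact ⟨fun a b => (key a).trans (key b).symm⟩

theorem ExtVanishes.left_of_exact {f : A →ₗ[R] B} {g : B →ₗ[R] C} (hf : Function.Injective f)
    (hfg : Function.Exact f g) (hg : Function.Surjective g) {i : ℕ}
    (hB : ExtVanishes R i B) (hC : ExtVanishes R (i + 1) C) : ExtVanishes R i A := by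
  have hS := shortExact_of_exact hf hfg hg
  have key (x : Abelian.Ext (ModuleCat.of R A) (ModuleCat.of R R) i) : x = 0 := by
    obtain ⟨y, rfl⟩ := Abelian.Ext.contravariant_sequence_exact₁ hS (ModuleCat.of R R) x
      (add_comm 1 i) (hC.elim _ _)
    rw [show y = 0 from hB.elim _ _, Abelian.Ext.comp_zero]
  exact ⟨fun a b => (key a).trans (key b).symm⟩

theorem ExtVanishes.one_of_extend {f : A →ₗ[R] B} {g : B →ₗ[R] C} (hf : Function.Injective f)
    (hfg : Function.Exact f g) (hg : Function.Surjective g)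
    (hext : ∀ u : A →ₗ[R] R, ∃ v : B →ₗ[R] R, u = v ∘ₗ f) (hB : ExtVanishes R 1 B) :
    ExtVanishes R 1 C := by
  have hS := shortExact_of_exact hf hfg hg
  have key (x : Abelian.Ext (ModuleCat.of R C) (ModuleCat.of R R) 1) : x = 0 := by
    obtain ⟨y, rfl⟩ := Abelian.Ext.contravariant_sequence_exact₃ hS (ModuleCat.of R R) x
      (hB.elim _ _) (add_comm 1 0)
    obtain ⟨u, rfl⟩ := (Abelian.Ext.mk₀_bijective _ _).2 y
    obtain ⟨v, hv⟩ := hext u.hom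
    have hu : u = ModuleCat.ofHom f ≫ ModuleCat.ofHom v := by
      ext x
      exact congr($hv x)
    rw [hu, ← Abelian.Ext.mk₀_comp_mk₀, ← Abelian.Ext.comp_assoc_of_second_deg_zero]
    rw [hS.extClass_comp, Abelian.Ext.zero_comp]
  exact ⟨fun a b => (key a).trans (key b).symm⟩

end

section

variable {R : Type} [CommRing R] {A B : Type} [AddCommGroup A] [Module R A]
  [AddCommGroup B] [Module R B]

theorem isTotallyReflexive_iff : IsTotallyReflexive R A ↔
    Module.Finite R A ∧ Function.Bijective (Module.Dual.eval R A) ∧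
      (∀ i, 0 < i → ExtVanishes R i A) ∧ ∀ i, 0 < i → ExtVanishes R i (Module.Dual R A) := by
  unfold IsTotallyReflexive
  refine and_congr_right' (and_congr_right' (and_congr ?_ ?_)) <;>
  exact forall₂_congr fun i hi => subsingleton_extMod_iff_extVanishes R _ i hi

theorem bijective_dual_eval_of_equiv (e : A ≃ₗ[R] B)
    (h : Function.Bijective (Module.Dual.eval R A)) :
    Function.Bijective (Module.Dual.eval R B) := by
  have : Module.IsReflexive R A := ⟨h⟩
  exact (Module.equiv e).bijective_dual_eval'

theorem IsTotallyReflexive.of_equiv (h : IsTotallyReflexive R A) (e : A ≃ₗ[R] B) :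
    IsTotallyReflexive R B := by
  rw [isTotallyReflexive_iff] at h ⊢
  obtain ⟨h1, h2, h3, h4⟩ := h
  exact ⟨Module.Finite.equiv e, bijective_dual_eval_of_equiv e h2,
    fun i hi => (h3 i hi).of_equiv e, fun i hi => (h4 i hi).of_equiv e.symm.dualMap⟩

theorem isTotallyReflexive_dual_of_extVanishes [IsNoetherianRing R] [Module.Finite R A]
    (h : Function.Bijective (Module.Dual.eval R A))
    (h1 : ∀ i, 0 < i → ExtVanishes R i A) (h2 : ∀ i, 0 < i → ExtVanishes R i (Module.Dual R A)) :
    IsTotallyReflexive R (Module.Dual R A) := by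
  rw [isTotallyReflexive_iff]
  have : Module.IsReflexive R A := ⟨h⟩
  refine ⟨inferInstance, Module.bijective_dual_eval R _, h2, fun i hi => ?_⟩
  exact (h1 i hi).of_equiv (Module.evalEquiv R A)

theorem isTotallyReflexive_of_projective [Module.Finite R A] [Module.Projective R A] :
    IsTotallyReflexive R A := by
  rw [isTotallyReflexive_iff]
  exact ⟨inferInstance, Module.bijective_dual_eval R A,
    fun i hi => extVanishes_of_projective hi, fun i hi => extVanishes_of_projective hi⟩

theorem GdimLE.of_iso {n : ℕ} {X Y : ModuleCat.{0} R} (h : GdimLE R n X) (e : X ≃ₗ[R] Y) :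
    GdimLE R n Y := by
  cases n with
  | zero => exact IsTotallyReflexive.of_equiv h e
  | succ n =>
    rcases h with h | ⟨G, f, hG, hf, hK⟩
    · exact Or.inl (h.of_equiv e)
    · refine Or.inr ⟨G, e.toLinearMap ∘ₗ f, hG, e.surjective.comp hf, ?_⟩
      rwa [LinearEquiv.ker_comp]

theorem GdimLE.extVanishes {n i : ℕ} (hi : n < i) {X : ModuleCat.{0} R} (h : GdimLE R n X) :
    ExtVanishes R i X := by
  induction n generalizing i X with
  | zero => exact (isTotallyReflexive_iff.1 h).2.2.1 i hi
  | succ n ih =>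
    rcases h with h | ⟨G, f, hG, hf, hK⟩
    · exact (isTotallyReflexive_iff.1 h).2.2.1 i (by lia)
    · obtain ⟨j, rfl⟩ := Nat.exists_eq_succ_of_ne_zero (show i ≠ 0 by lia)
      exact ExtVanishes.right_of_exact (LinearMap.ker f).injective_subtype
        (LinearMap.exact_subtype_ker_map f) hf (ih (by lia) hK)
        ((isTotallyReflexive_iff.1 hG).2.2.1 _ (by lia))

end

section

variable {R : Type} [CommRing R] {C : ℤ → Type} [∀ n, AddCommGroup (C n)] [∀ n, Module R (C n)]
  {d : ∀ n, C n →ₗ[R] C (n + 1)}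

theorem exists_extend_of_dual_exact (hex : ∀ n, Function.Exact (d n) (d (n + 1)))
    (hdual : ∀ n (u : Module.Dual R (C (n + 1))), u ∘ₗ d n = 0 →
      ∃ v : Module.Dual R (C (n + 1 + 1)), u = v ∘ₗ d (n + 1))
    (n : ℤ) (u : Module.Dual R (LinearMap.range (d n))) :
    ∃ v : Module.Dual R (C (n + 1)), u = v ∘ₗ (LinearMap.range (d n)).subtype := by
  obtain ⟨m, rfl⟩ : ∃ m, n = m + 1 := ⟨n - 1, by ring⟩
  obtain ⟨v, hv⟩ := hdual m (u ∘ₗ (d (m + 1)).rangeRestrict) (by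
    ext x
    have : (d (m + 1)).rangeRestrict (d m x) = 0 :=
      Subtype.ext ((hex m).apply_apply_eq_zero x)
    simp [this])
  refine ⟨v, ?_⟩
  ext ⟨_, x, rfl⟩
  exact congr($hv x)

variable [∀ n, Module.Projective R (C n)]

theorem extVanishes_range (hex : ∀ n, Function.Exact (d n) (d (n + 1)))
    (hdual : ∀ n (u : Module.Dual R (C (n + 1))), u ∘ₗ d n = 0 →
      ∃ v : Module.Dual R (C (n + 1 + 1)), u = v ∘ₗ d (n + 1))
    (n : ℤ) (i : ℕ) : ExtVanishes R (i + 1) (LinearMap.range (d n)) := by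
  have hexact (m : ℤ) : Function.Exact (LinearMap.range (d m)).subtype
      (d (m + 1)).rangeRestrict := by
    intro x
    rw [← Submodule.coe_eq_zero]
    simpa using hex m x
  induction i generalizing n with
  | zero =>
    obtain ⟨m, rfl⟩ : ∃ m, n = m + 1 := ⟨n - 1, by ring⟩
    exact ExtVanishes.one_of_extend (Submodule.injective_subtype _) (hexact m)
      (LinearMap.surjective_rangeRestrict _) (exists_extend_of_dual_exact hex hdual m)
      (extVanishes_of_projective one_pos)
  | succ i ih =>
    obtain ⟨m, rfl⟩ : ∃ m, n = m + 1 := ⟨n - 1, by ring⟩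
    exact ExtVanishes.right_of_exact (Submodule.injective_subtype _) (hexact m)
      (LinearMap.surjective_rangeRestrict _) (ih m) (extVanishes_of_projective (by lia))

theorem bijective_dual_eval_range [∀ n, Module.Finite R (C n)]
    (hex : ∀ n, Function.Exact (d n) (d (n + 1)))
    (hdual : ∀ n (u : Module.Dual R (C (n + 1))), u ∘ₗ d n = 0 →
      ∃ v : Module.Dual R (C (n + 1 + 1)), u = v ∘ₗ d (n + 1)) (n : ℤ) :
    Function.Bijective (Module.Dual.eval R (LinearMap.range (d n))) := by
  constructor
  · rw [← LinearMap.ker_eq_bot, LinearMap.ker_eq_bot']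
    intro z hz
    refine Subtype.ext ((Module.forall_dual_apply_eq_zero_iff R _).1 fun u => ?_)
    exact congr($hz (u ∘ₗ (LinearMap.range (d n)).subtype))
  · intro ξ
    obtain ⟨c, hc⟩ := (Module.bijective_dual_eval R (C (n + 1))).2
      (ξ ∘ₗ (LinearMap.range (d n)).subtype.dualMap)
    have hc' (u : Module.Dual R (C (n + 1))) :
        u c = ξ (u ∘ₗ (LinearMap.range (d n)).subtype) := congr($hc u)
    have hdc : d (n + 1) c = 0 := by
      refine (Module.forall_dual_apply_eq_zero_iff R _).1 fun u => ?_
      have h0 : (u ∘ₗ d (n + 1)) ∘ₗ (LinearMap.range (d n)).subtype = 0 := by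
        ext ⟨_, x, rfl⟩
        simp [(hex n).apply_apply_eq_zero x]
      simpa [h0] using hc' (u ∘ₗ d (n + 1))
    refine ⟨⟨c, (hex n c).1 hdc⟩, ?_⟩
    ext u
    obtain ⟨v, rfl⟩ := exists_extend_of_dual_exact hex hdual n u
    exact hc' v

end

section

variable (R : Type) [CommRing R] [IsNoetherianRing R]

/-- Every finitely generated module is a quotient of a finite free module. -/
theorem exists_epi_fgModuleCat (X : FGModuleCat.{0} R) :
    ∃ (n : ℕ) (π : FGModuleCat.of R (Fin n → R) ⟶ X), Epi π := by
  obtain ⟨n, f, hf⟩ := Module.Finite.exists_fin' R X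
  let π : FGModuleCat.of R (Fin n → R) ⟶ X := ⟨ModuleCat.ofHom f⟩
  have : Epi ((forget₂ (FGModuleCat R) (ModuleCat R)).map π) :=
    (ModuleCat.epi_iff_surjective _).2 hf
  exact ⟨n, π, Functor.epi_of_epi_map (forget₂ (FGModuleCat R) (ModuleCat R)) this⟩

theorem projective_fgModuleCat_of_projective (X : FGModuleCat.{0} R) [Module.Projective R X] :
    Projective X :=
  ⟨fun {E Z} f e he => by
    have hF : Epi ((forget₂ (FGModuleCat R) (ModuleCat R)).map e) := inferInstance
    obtain ⟨h, hh⟩ := Module.projective_lifting_property e.hom.hom f.hom.hom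
      ((ModuleCat.epi_iff_surjective _).1 hF)
    exact ⟨⟨ModuleCat.ofHom h⟩, FGModuleCat.hom_ext hh⟩⟩

instance : EnoughProjectives (FGModuleCat.{0} R) where
  presentation X := by
    obtain ⟨n, π, hπ⟩ := exists_epi_fgModuleCat R X
    have := projective_fgModuleCat_of_projective R (FGModuleCat.of R (Fin n → R))
    exact ⟨{ p := _, f := π }⟩

instance : (forget₂ (FGModuleCat.{0} R) (ModuleCat.{0} R)).PreservesProjectiveObjects where
  projective_obj {X} hX := by
    obtain ⟨n, π, hπ⟩ := exists_epi_fgModuleCat R X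
    let F := forget₂ (FGModuleCat R) (ModuleCat R)
    have : Projective (F.obj (FGModuleCat.of R (Fin n → R))) :=
      inferInstanceAs (Projective (ModuleCat.of R (Fin n → R)))
    exact (Retract.map ⟨Projective.factorThru (𝟙 X) π, π, by simp⟩ F).projective

/-- Over a noetherian ring, finitely generated modules have resolutions by finitely generated
projective modules. -/
theorem exists_finite_projectiveResolution (M : Type) [AddCommGroup M] [Module R M]
    [Module.Finite R M] : ∃ P : ProjectiveResolution (ModuleCat.of R M),
      ∀ n, Module.Finite R (P.complex.X n) :=
  ⟨(forget₂ (FGModuleCat R) (ModuleCat R)).mapProjectiveResolution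
    (ProjectiveResolution.of (FGModuleCat.of R M)), fun n =>
      ((ProjectiveResolution.of (FGModuleCat.of R M)).complex.X n).property⟩

end

section

variable {R : Type} [CommRing R]

/-- The cochain complex `Hom(L, R)`, shifted so that the dual of `L_j` sits in degree `c - j`. -/
noncomputable def dualComplex (c : ℤ) (L : CochainComplex (ModuleCat.{0} R) ℤ) :
    CochainComplex (ModuleCat.{0} R) ℤ where
  X i := ModuleCat.of R (Module.Dual R (L.X (c - i)))
  d i j := ModuleCat.ofHom (L.d (c - j) (c - i)).hom.dualMap
  shape i j h := by
    rw [L.shape _ _ (by simp only [ComplexShape.up_Rel] at h ⊢; lia)]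
    ext
    simp
  d_comp_d' i j k _ _ := by
    refine ModuleCat.hom_ext (LinearMap.ext fun u : Module.Dual R (L.X (c - i)) => ?_)
    refine LinearMap.ext (σ := RingHom.id R) fun x : L.X (c - k) => ?_
    have h := congr(u ($(L.d_comp_d (c - k) (c - j) (c - i)) x))
    exact h.trans (map_zero u)

variable {M : Type} [AddCommGroup M] [Module R M] (P : ProjectiveResolution (ModuleCat.of R M))

/-- The dual of a projective resolution, restricted to its support, computes `Ext(M, R)`. -/
noncomputable def dualComplexRestrictionIso (c : ℤ) :
    (dualComplex c P.cochainComplex).restriction (ComplexShape.embeddingUpIntGE c) ≅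
      P.complex.linearYonedaObj R (ModuleCat.of R R) :=
  HomologicalComplex.Hom.isoOfComponents
    (fun k => ((P.cochainComplexXIso (c - (c + k)) k (by lia)).toLinearEquiv.dualMap.symm ≪≫ₗ
      (ModuleCat.homLinearEquiv (S := R) (M := P.complex.X k)
        (N := ModuleCat.of R R)).symm).toModuleIso)
    (fun k l h => by
      have hd := congr((P.cochainComplexXIso (c - (c + l)) l (by lia)).inv ≫
        $(P.cochainComplex_d (c - (c + l)) (c - (c + k)) l k (by lia) (by lia)))
      rw [Iso.inv_hom_id_assoc] at hd
      refine ModuleCat.hom_ext (LinearMap.ext fun u => ModuleCat.hom_ext (LinearMap.ext fun x => ?_))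
      exact congr((show Module.Dual R (P.cochainComplex.X (c - (c + k))) from u) ($(hd) x)).symm)

theorem dualComplex_isStrictlyGE (c : ℤ) :
    (dualComplex c P.cochainComplex).IsStrictlyGE c := by
  rw [CochainComplex.isStrictlyGE_iff]
  intro i hi
  have h := P.cochainComplex.isZero_of_isStrictlyLE 0 (c - i) (by lia)
  have := ModuleCat.subsingleton_of_isZero h
  exact ModuleCat.isZero_of_subsingleton
    (ModuleCat.of R (Module.Dual R (P.cochainComplex.X (c - i))))

/-- The cohomology of the dual of a projective resolution is `Ext(M, R)`. -/
theorem nonempty_homology_dualComplex_iso (c : ℤ) (k : ℕ) :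
    Nonempty ((dualComplex c P.cochainComplex).homology (c + k) ≅ ExtMod R M R k) := by
  have := dualComplex_isStrictlyGE P c
  let e := ComplexShape.embeddingUpIntGE c
  let D := dualComplex c P.cochainComplex
  have : ∀ k, IsIso ((HomologicalComplex.restrictionToTruncGE' D e).f k) := inferInstance
  have : IsIso (HomologicalComplex.restrictionToTruncGE' D e) :=
    HomologicalComplex.Hom.isIso_of_components _
  exact ⟨(HomologicalComplex.homologyFunctor _ _ (c + k)).mapIso
      (asIso (HomologicalComplex.πTruncGE D e)) ≪≫
    (HomologicalComplex.truncGE' D e).extendHomologyIso e rfl ≪≫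
    (HomologicalComplex.homologyFunctor _ _ k).mapIso
      (asIso (HomologicalComplex.restrictionToTruncGE' D e)).symm ≪≫
    (HomologicalComplex.homologyFunctor _ _ k).mapIso (dualComplexRestrictionIso P c) ≪≫
    (P.isoExt k (ModuleCat.of R R)).symm⟩

end

section

universe w v u

variable {C : Type u} [Category.{v} C] [Abelian C]

open DerivedCategory in
/-- Morphisms in the derived category out of a K-projective complex lift to chain maps. -/
theorem exists_Q_map_eq [HasDerivedCategory.{w} C] {K L : CochainComplex C ℤ} [K.IsKProjective]
    (f : Q.obj K ⟶ Q.obj L) : ∃ φ : K ⟶ L, Q.map φ = f := by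
  obtain ⟨φ, hφ⟩ := (CochainComplex.IsKProjective.Qh_map_bijective K
    ((HomotopyCategory.quotient _ _).obj L)).2
      ((quotientCompQhIso C).hom.app K ≫ f ≫ (quotientCompQhIso C).inv.app L)
  obtain ⟨ψ, rfl⟩ := (HomotopyCategory.quotient _ _).map_surjective φ
  refine ⟨ψ, ?_⟩
  have h := (quotientCompQhIso C).inv.naturality ψ
  rw [← cancel_mono ((quotientCompQhIso C).inv.app L), h, Functor.comp_map, hφ]
  simp

open DerivedCategory in
theorem nonempty_homotopy_of_Q_map_eq [HasDerivedCategory.{w} C] {K L : CochainComplex C ℤ}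
    [K.IsKProjective] {f g : K ⟶ L} (h : Q.map f = Q.map g) : Nonempty (Homotopy f g) := by
  refine ⟨HomotopyCategory.homotopyOfEq _ _
    ((CochainComplex.IsKProjective.Qh_map_bijective K _).1 ?_)⟩
  have hf := (quotientCompQhIso C).hom.naturality f
  have hg := (quotientCompQhIso C).hom.naturality g
  rw [h, ← hg] at hf
  exact (cancel_mono _).1 hf

/-- Chain maps out of a K-projective complex lift along quasi-isomorphisms up to homotopy. -/
theorem exists_lift_of_quasiIso {K L L' : CochainComplex C ℤ} [K.IsKProjective] (q : L ⟶ L')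
    [QuasiIso q] (f : K ⟶ L') : ∃ t : K ⟶ L, Nonempty (Homotopy f (t ≫ q)) := by
  let := HasDerivedCategory.standard C
  obtain ⟨t, ht⟩ := exists_Q_map_eq (DerivedCategory.Q.map f ≫ inv (DerivedCategory.Q.map q))
  exact ⟨t, nonempty_homotopy_of_Q_map_eq (by simp [ht])⟩

open DerivedCategory in
/-- Complexes with isomorphic cohomology concentrated in degree `0` are quasi-isomorphic, and the
quasi-isomorphism is a chain map if the source is K-projective. -/
theorem exists_quasiIso_of_homology_iso {K L : CochainComplex C ℤ} [K.IsKProjective]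
    [K.IsGE 0] [K.IsLE 0] [L.IsGE 0] [L.IsLE 0] (e : K.homology 0 ≅ L.homology 0) :
    ∃ q : K ⟶ L, QuasiIso q := by
  let := HasDerivedCategory.standard C
  have key (K : CochainComplex C ℤ) [K.IsGE 0] [K.IsLE 0] :
      Nonempty (Q.obj K ≅ (singleFunctor C 0).obj (K.homology 0)) := by
    obtain ⟨Y, ⟨eY⟩⟩ := exists_iso_singleFunctor_obj_of_isGE_of_isLE (Q.obj K) 0
    exact ⟨eY ≪≫ (singleFunctor C 0).mapIso
      ((singleFunctorCompHomologyFunctorIso C 0).symm.app Y ≪≫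
        (homologyFunctor C 0).mapIso eY.symm ≪≫ (homologyFunctorFactors C 0).app K)⟩
  obtain ⟨eK⟩ := key K
  obtain ⟨eL⟩ := key L
  obtain ⟨q, hq⟩ := exists_Q_map_eq (eK ≪≫ (singleFunctor C 0).mapIso e ≪≫ eL.symm).hom
  refine ⟨q, (isIso_Q_map_iff_quasiIso C q).1 ?_⟩
  rw [hq]
  infer_instance

end

section

variable {R : Type} [CommRing R] {c : ℤ} {L L' L'' : CochainComplex (ModuleCat.{0} R) ℤ}

/-- A map `L_i ⟶ (L'_j)^*`, viewed as a bilinear pairing of `L_i` and `L'_j`. -/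
noncomputable def dualPairing {i k : ℤ} (φ : L.X i ⟶ (dualComplex c L').X k) (j : ℤ)
    (h : j = c - k) : L.X i →ₗ[R] Module.Dual R (L'.X j) :=
  (L'.XIsoOfEq h).hom.hom.dualMap ∘ₗ φ.hom

theorem dualPairing_injective {i k : ℤ} {φ ψ : L.X i ⟶ (dualComplex c L').X k} (j : ℤ)
    (h : j = c - k) (H : ∀ x y, dualPairing φ j h x y = dualPairing ψ j h x y) : φ = ψ := by
  subst h
  exact ModuleCat.hom_ext (LinearMap.ext fun x => LinearMap.ext (σ := RingHom.id R) fun y => H x y)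

theorem dualPairing_comp {X : ℤ} {i k : ℤ} (φ : L.X i ⟶ (dualComplex c L').X k)
    (f : L''.X X ⟶ L.X i) (j : ℤ) (h : j = c - k) (x : L''.X X) :
    dualPairing (f ≫ φ) j h x = dualPairing φ j h (f x) :=
  rfl

theorem dualPairing_comp_d {i k k' : ℤ} (φ : L.X i ⟶ (dualComplex c L').X k) (j j' : ℤ)
    (h : j = c - k) (h' : j' = c - k') (x : L.X i) (y : L'.X j') :
    dualPairing (φ ≫ (dualComplex c L').d k k') j' h' x y =
      dualPairing φ j h x (L'.d j' j y) := by
  subst h h'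
  rfl

theorem dualPairing_add {i k : ℤ} (φ ψ : L.X i ⟶ (dualComplex c L').X k) (j : ℤ)
    (h : j = c - k) : dualPairing (φ + ψ) j h = dualPairing φ j h + dualPairing ψ j h := by
  subst h
  rfl

/-- The transpose of a pairing `L_i ⟶ (L'_j)^*`. -/
noncomputable def transposeHom {i k : ℤ} (φ : L.X i ⟶ (dualComplex c L').X k) (j l : ℤ)
    (h : j = c - k) (h' : i = c - l) : L'.X j ⟶ (dualComplex c L).X l :=
  ModuleCat.ofHom ((L.XIsoOfEq h').inv.hom.dualMap ∘ₗ (dualPairing φ j h).flip)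

theorem dualPairing_transposeHom {i k : ℤ} (φ : L.X i ⟶ (dualComplex c L').X k) (j l : ℤ)
    (h : j = c - k) (h' : i = c - l) (x : L.X i) (y : L'.X j) :
    dualPairing (transposeHom φ j l h h') i h' y x = dualPairing φ j h x y := by
  subst h h'
  rfl

/-- The adjunction property of a chain map `L ⟶ Hom(L', R)` viewed as a pairing. -/
theorem dualPairing_d (q : L ⟶ dualComplex c L') (i i' j j' : ℤ) (h : j = c - i)
    (h' : j' = c - i') (x : L.X i) (y : L'.X j') :
    dualPairing (q.f i') j' h' (L.d i i' x) y = dualPairing (q.f i) j h x (L'.d j' j y) := by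
  rw [← dualPairing_comp, ← q.comm, dualPairing_comp_d _ j j' h h']

/-- The transpose of a chain map `L ⟶ Hom(L', R)`. -/
noncomputable def transposeMap (q : L ⟶ dualComplex c L') : L' ⟶ dualComplex c L where
  f j := transposeHom (q.f (c - j)) j j (by lia) rfl
  comm' j j' _ := by
    refine dualPairing_injective (c - j') rfl fun y x => ?_
    rw [dualPairing_comp_d _ (c - j) (c - j') rfl rfl, dualPairing_comp, dualPairing_transposeHom,
      dualPairing_transposeHom, dualPairing_d q (c - j') (c - j) j' j (by lia)]

theorem dualPairing_transposeMap (q : L ⟶ dualComplex c L') (i j : ℤ) (h : j = c - i)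
    (h' : i = c - j) (x : L.X i) (y : L'.X j) :
    dualPairing ((transposeMap q).f j) i h' y x = dualPairing (q.f i) j h x y := by
  subst h'
  exact dualPairing_transposeHom _ _ _ _ _ x y

theorem transposeMap_transposeMap (q : L ⟶ dualComplex c L') :
    transposeMap (transposeMap q) = q := by
  ext i : 1
  refine dualPairing_injective (c - i) rfl fun x y => ?_
  rw [dualPairing_transposeMap _ _ _ (by lia), dualPairing_transposeMap]

/-- The transpose of a homotopy. -/
noncomputable def transposeHomotopy {q q' : L ⟶ dualComplex c L'} (H : Homotopy q q') :
    Homotopy (transposeMap q) (transposeMap q') where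
  hom j l := transposeHom (H.hom (c - l) (c - j)) j l (by lia) rfl
  zero j l hjl := by
    rw [H.zero _ _ (by simp only [ComplexShape.up_Rel] at hjl ⊢; lia)]
    rfl
  comm j := by
    refine dualPairing_injective (c - j) rfl fun y x => ?_
    rw [dNext_eq _ (show (ComplexShape.up ℤ).Rel j (j + 1) from rfl),
      prevD_eq _ (show (ComplexShape.up ℤ).Rel (j - 1) j by simp), dualPairing_add, dualPairing_add]
    simp only [LinearMap.add_apply]
    rw [dualPairing_comp, dualPairing_comp_d _ (c - (j - 1)) (c - j) rfl rfl,
      dualPairing_transposeHom, dualPairing_transposeHom,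
      dualPairing_transposeMap q _ _ (by lia), dualPairing_transposeMap q' _ _ (by lia), H.comm,
      dNext_eq _ (show (ComplexShape.up ℤ).Rel (c - j) (c - (j - 1)) by simp; lia),
      prevD_eq _ (show (ComplexShape.up ℤ).Rel (c - (j + 1)) (c - j) by simp; lia),
      dualPairing_add, dualPairing_add]
    simp only [LinearMap.add_apply]
    rw [dualPairing_comp, dualPairing_comp_d _ (j + 1) j (by lia) (by lia)]
    abel

/-- The contravariant functoriality of the dual complex. -/
noncomputable def dualComplexMap (c : ℤ) (t : L ⟶ L') : dualComplex c L' ⟶ dualComplex c L where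
  f i := ModuleCat.ofHom (t.f (c - i)).hom.dualMap
  comm' i j _ := by
    refine ModuleCat.hom_ext (LinearMap.ext fun u : Module.Dual R (L'.X (c - i)) => ?_)
    refine LinearMap.ext (σ := RingHom.id R) fun x : L.X (c - j) => ?_
    exact congr(u ($(t.comm (c - j) (c - i)) x)).symm

theorem transposeMap_comp (t : L ⟶ L') (q : L' ⟶ dualComplex c L'') :
    transposeMap (t ≫ q) = transposeMap q ≫ dualComplexMap c t := by
  ext j : 1
  refine dualPairing_injective (c - j) rfl fun y x => ?_
  rw [dualPairing_transposeMap _ _ _ (by lia), HomologicalComplex.comp_f, dualPairing_comp,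
    ← dualPairing_transposeMap _ _ _ _ rfl]
  rfl

end

section

variable {R : Type} [CommRing R]

theorem finite_homology [IsNoetherianRing R] {ι : Type*} {s : ComplexShape ι}
    (L : HomologicalComplex (ModuleCat.{0} R) s) (i : ι) [Module.Finite R (L.X i)] :
    Module.Finite R (L.homology i) := by
  have := Module.Finite.of_surjective (L.pOpcycles i).hom
    ((ModuleCat.epi_iff_surjective _).1 inferInstance)
  exact Module.Finite.of_injective (L.homologyι i).hom
    ((ModuleCat.mono_iff_injective _).1 inferInstance)

theorem isIso_of_epi_endomorphism {X : ModuleCat.{0} R} [Module.Finite R X] (f : X ⟶ X) [Epi f] :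
    IsIso f := by
  rw [ConcreteCategory.isIso_iff_bijective]
  exact OrzechProperty.bijective_of_surjective_endomorphism f.hom
    ((ModuleCat.epi_iff_surjective _).1 inferInstance)

/-- The transpose of a quasi-isomorphism from a complex of finitely generated modules to its own
dual is again a quasi-isomorphism. -/
theorem quasiIso_transposeMap [IsNoetherianRing R] {c : ℤ}
    {L : CochainComplex (ModuleCat.{0} R) ℤ} [L.IsKProjective]
    [∀ i, Module.Finite R (L.X i)] (q : L ⟶ dualComplex c L) [QuasiIso q] :
    QuasiIso (transposeMap q) := by
  obtain ⟨t, ⟨H⟩⟩ := exists_lift_of_quasiIso q (transposeMap q)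
  have H' := transposeHomotopy H
  rw [transposeMap_transposeMap, transposeMap_comp] at H'
  refine ⟨fun i => ?_⟩
  rw [quasiIsoAt_iff_isIso_homologyMap]
  have hq : IsIso (HomologicalComplex.homologyMap q i) := inferInstance
  have hcomp := H'.homologyMap_eq i
  rw [HomologicalComplex.homologyMap_comp] at hcomp
  have := finite_homology L i
  have : Module.Finite R ((dualComplex c L).homology i) :=
    Module.Finite.equiv (asIso (HomologicalComplex.homologyMap q i)).toLinearEquiv
  have : Epi (HomologicalComplex.homologyMap (transposeMap q) i ≫
      HomologicalComplex.homologyMap (dualComplexMap c t) i) := hcomp ▸ inferInstance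
  have := epi_of_epi (HomologicalComplex.homologyMap (transposeMap q) i)
    (HomologicalComplex.homologyMap (dualComplexMap c t) i)
  have := isIso_of_epi_endomorphism (HomologicalComplex.homologyMap (dualComplexMap c t) i)
  have : IsIso (HomologicalComplex.homologyMap (transposeMap q) i ≫
      HomologicalComplex.homologyMap (dualComplexMap c t) i) := hcomp ▸ inferInstance
  exact IsIso.of_isIso_comp_right _ (HomologicalComplex.homologyMap (dualComplexMap c t) i)

/-- A quasi-isomorphism is injective on cohomology classes. -/
theorem exists_eq_d_of_quasiIso {K L : CochainComplex (ModuleCat.{0} R) ℤ} (q : K ⟶ L) [QuasiIso q]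
    (i j k : ℤ) (hij : i + 1 = j) (hjk : j + 1 = k) (x : K.X j) (hx : K.d j k x = 0) (w : L.X i)
    (hw : q.f j x = L.d i j w) : ∃ z : K.X i, K.d i j z = x := by
  have h := (HomologicalComplex.mono_homologyMap_iff_up_to_refinements q i j k (by simp; lia)
    (by simp; lia)).1 inferInstance
  obtain ⟨A', π, hπ, z, hz⟩ := h (A := ModuleCat.of R R)
    (ModuleCat.ofHom (LinearMap.toSpanSingleton R _ x))
    (ModuleCat.hom_ext (LinearMap.ext_ring (by simpa using hx)))
    (ModuleCat.ofHom (LinearMap.toSpanSingleton R _ w))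
    (ModuleCat.hom_ext (LinearMap.ext_ring (by simpa using hw)))
  obtain ⟨a, ha⟩ := (ModuleCat.epi_iff_surjective π).1 hπ (1 : R)
  refine ⟨z a, ?_⟩
  have := congr($hz a)
  simpa [ha] using this.symm

/-- A quasi-isomorphism is surjective on cohomology classes. -/
theorem exists_eq_add_d_of_quasiIso {K L : CochainComplex (ModuleCat.{0} R) ℤ} (q : K ⟶ L)
    [QuasiIso q] (i j k : ℤ) (hij : i + 1 = j) (hjk : j + 1 = k) (y : L.X j) (hy : L.d j k y = 0) :
    ∃ (x : K.X j) (w : L.X i), K.d j k x = 0 ∧ y = q.f j x + L.d i j w := by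
  have h := (HomologicalComplex.epi_homologyMap_iff_up_to_refinements q i j k (by simp; lia)
    (by simp; lia)).1 inferInstance
  obtain ⟨A', π, hπ, z, hz, w, hw⟩ := h (A := ModuleCat.of R R)
    (ModuleCat.ofHom (LinearMap.toSpanSingleton R _ y))
    (ModuleCat.hom_ext (LinearMap.ext_ring (by simpa using hy)))
  obtain ⟨a, ha⟩ := (ModuleCat.epi_iff_surjective π).1 hπ (1 : R)
  refine ⟨z a, w a, congr($hz a), ?_⟩
  have := congr($hw a)
  simpa [ha] using this

end

section

variable {R : Type} [CommRing R] {c : ℤ} {L : CochainComplex (ModuleCat.{0} R) ℤ}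

theorem exists_eq_d_of_dualPairing (q : L ⟶ dualComplex c L) [QuasiIso q] {i j k m m' : ℤ}
    (hij : i + 1 = j) (hjk : j + 1 = k) (hm : m = c - j) (hm' : m' = c - i) (x : L.X j)
    (hx : L.d j k x = 0) (u : Module.Dual R (L.X m'))
    (hu : ∀ y, dualPairing (q.f j) m hm x y = u (L.d m m' y)) : ∃ z : L.X i, L.d i j z = x := by
  subst hm hm'
  exact exists_eq_d_of_quasiIso q i j k hij hjk x hx (show (dualComplex c L).X i from u)
    (LinearMap.ext (σ := RingHom.id R) hu)

theorem exists_eq_add_of_dualPairing (q : L ⟶ dualComplex c L) [QuasiIso q] {i j k m₀ m m' : ℤ}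
    (hij : i + 1 = j) (hjk : j + 1 = k) (hm₀ : m₀ = c - k) (hm : m = c - j) (hm' : m' = c - i)
    (u : Module.Dual R (L.X m)) (hu : ∀ y, u (L.d m₀ m y) = 0) :
    ∃ (x : L.X j) (v : Module.Dual R (L.X m')), L.d j k x = 0 ∧
      ∀ y, u y = dualPairing (q.f j) m hm x y + v (L.d m m' y) := by
  subst hm hm' hm₀
  obtain ⟨x, v, hx, hv⟩ := exists_eq_add_d_of_quasiIso q i j k hij hjk
    (show (dualComplex c L).X j from u) (LinearMap.ext (σ := RingHom.id R) hu)
  exact ⟨x, v, hx, fun y => congr((show Module.Dual R (L.X (c - j)) from $hv) y)⟩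

/-- The terms of the mapping cone of a chain map `L ⟶ Hom(L, R)`. -/
abbrev coneX (c : ℤ) (L : CochainComplex (ModuleCat.{0} R) ℤ) (n : ℤ) : Type :=
  L.X (n + 1) × Module.Dual R (L.X (c - n))

/-- The differentials of the mapping cone of a chain map `L ⟶ Hom(L, R)`. -/
noncomputable def coneD (q : L ⟶ dualComplex c L) (n : ℤ) :
    coneX c L n →ₗ[R] coneX c L (n + 1) :=
  LinearMap.prod (-((L.d (n + 1) (n + 1 + 1)).hom ∘ₗ LinearMap.fst R _ _))
    (dualPairing (q.f (n + 1)) (c - (n + 1)) rfl ∘ₗ LinearMap.fst R _ _ +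
      (L.d (c - (n + 1)) (c - n)).hom.dualMap ∘ₗ LinearMap.snd R _ _)

theorem coneD_fst (q : L ⟶ dualComplex c L) (n : ℤ) (x : coneX c L n) :
    (coneD q n x).1 = -L.d (n + 1) (n + 1 + 1) x.1 :=
  rfl

theorem coneD_snd (q : L ⟶ dualComplex c L) (n : ℤ) (x : coneX c L n) (y : L.X (c - (n + 1))) :
    (coneD q n x).2 y = dualPairing (q.f (n + 1)) (c - (n + 1)) rfl x.1 y +
      x.2 (L.d (c - (n + 1)) (c - n) y) :=
  rfl

theorem d_d_apply (i j k : ℤ) (x : L.X i) : L.d j k (L.d i j x) = 0 :=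
  congr($(L.d_comp_d i j k) x)

theorem exact_coneD (q : L ⟶ dualComplex c L) [QuasiIso q] (n : ℤ) :
    Function.Exact (coneD q n) (coneD q (n + 1)) := by
  rintro ⟨x, f⟩
  constructor
  · intro h
    have hx : L.d (n + 1 + 1) (n + 1 + 1 + 1) x = 0 := neg_eq_zero.1 congr($(h).1)
    have hf (y : L.X (c - (n + 1 + 1))) :
        dualPairing (q.f (n + 1 + 1)) (c - (n + 1 + 1)) rfl x y =
          -f (L.d (c - (n + 1 + 1)) (c - (n + 1)) y) :=
      eq_neg_of_add_eq_zero_left congr($(h).2 y)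
    obtain ⟨z, rfl⟩ := exists_eq_d_of_dualPairing q rfl rfl rfl rfl x hx (-f) hf
    obtain ⟨w, v, hw, hv⟩ := exists_eq_add_of_dualPairing q (i := n) rfl rfl rfl rfl rfl
      (f + dualPairing (q.f (n + 1)) (c - (n + 1)) rfl z) (fun y => by
        rw [LinearMap.add_apply, ← dualPairing_d q _ _ _ _ rfl rfl, hf, add_neg_cancel])
    refine ⟨(w - z, v), Prod.ext ?_ (LinearMap.ext fun y => ?_)⟩
    · rw [coneD_fst, map_sub, hw, zero_sub, neg_neg]
    · have := hv y
      rw [LinearMap.add_apply] at this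
      rw [coneD_snd, map_sub, LinearMap.sub_apply, sub_add_eq_add_sub, ← this, add_sub_cancel_right]
  · rintro ⟨⟨z, v⟩, h⟩
    rw [← h]
    refine Prod.ext ?_ (LinearMap.ext fun y => ?_)
    · rw [coneD_fst, coneD_fst, map_neg, d_d_apply, neg_zero, neg_zero]
      rfl
    · rw [coneD_snd, coneD_snd, coneD_fst, map_neg, LinearMap.neg_apply, dualPairing_d q _ _ _ _ rfl,
        d_d_apply, map_zero, add_zero, neg_add_cancel]
      rfl

theorem exists_eq_comp_coneD [∀ i, Module.Finite R (L.X i)] [∀ i, Module.Projective R (L.X i)]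
    (q : L ⟶ dualComplex c L) [QuasiIso (transposeMap q)] (n : ℤ)
    (u : Module.Dual R (coneX c L (n + 1))) (hu : u ∘ₗ coneD q n = 0) :
    ∃ v : Module.Dual R (coneX c L (n + 1 + 1)), u = v ∘ₗ coneD q (n + 1) := by
  obtain ⟨p, hp⟩ := (Module.bijective_dual_eval R (L.X (c - (n + 1)))).2 (u ∘ₗ LinearMap.inr R _ _)
  set a : Module.Dual R (L.X (n + 1 + 1)) := u ∘ₗ LinearMap.inl R _ _ with ha
  have hup (x f) : u (x, f) = a x + f p := by
    have : f p = u (0, f) := congr($hp f)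
    rw [this, ha]
    simp [← map_add]
  have hx (x : L.X (n + 1)) : dualPairing (q.f (n + 1)) (c - (n + 1)) rfl x p =
      a (L.d (n + 1) (n + 1 + 1) x) := by
    have h : u (coneD q n (x, 0)) = 0 := congr($hu (x, 0))
    have heq : (-L.d (n + 1) (n + 1 + 1) x, dualPairing (q.f (n + 1)) (c - (n + 1)) rfl x) =
        coneD q n (x, 0) := Prod.ext rfl (LinearMap.ext fun y => by
      rw [coneD_snd]
      exact (add_zero _).symm)
    have := (congrArg u heq).trans h
    rw [hup, map_neg] at this
    exact (neg_add_eq_zero.1 this).symm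
  have hdp : L.d (c - (n + 1)) (c - n) p = 0 := by
    refine (Module.forall_dual_apply_eq_zero_iff R _).1 fun f => ?_
    have h : u (coneD q n (0, f)) = 0 := congr($hu (0, f))
    have heq : (0, f ∘ₗ (L.d (c - (n + 1)) (c - n)).hom) = coneD q n (0, f) := by
      refine Prod.ext ?_ (LinearMap.ext fun y => ?_)
      · rw [coneD_fst, map_zero, neg_zero]
      · rw [coneD_snd, map_zero, LinearMap.zero_apply, zero_add]
        rfl
    have := (congrArg u heq).trans h
    rw [hup, map_zero, zero_add] at this
    exact this
  obtain ⟨r, rfl⟩ := exists_eq_d_of_dualPairing (transposeMap q) (i := c - (n + 1 + 1))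
    (m := n + 1) (m' := n + 1 + 1) (by lia) (by lia) (by lia) (by lia) p hdp a (fun x => by
      rw [dualPairing_transposeMap q _ _ rfl, hx])
  obtain ⟨s, b, hs, hb⟩ := exists_eq_add_of_dualPairing (transposeMap q)
    (i := c - (n + 1 + 1 + 1)) (j := c - (n + 1 + 1)) (k := c - (n + 1)) (m₀ := n + 1)
    (m := n + 1 + 1) (m' := n + 1 + 1 + 1) (by lia) (by lia) (by lia) (by lia) (by lia)
    (a - dualPairing ((transposeMap q).f (c - (n + 1 + 1))) (n + 1 + 1) (by lia) r) (fun x => by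
      rw [LinearMap.sub_apply, ← dualPairing_d (transposeMap q) _ (c - (n + 1)) _ _ (by lia) (by lia),
        dualPairing_transposeMap q _ _ rfl, hx, sub_self])
  refine ⟨(LinearMap.coprod (-b) (Module.Dual.eval R _ (r + s))), LinearMap.ext fun ⟨x, f⟩ => ?_⟩
  have hbx := hb x
  rw [LinearMap.sub_apply, sub_eq_iff_eq_add] at hbx
  rw [hup, hbx, LinearMap.comp_apply, LinearMap.coprod_apply, Module.Dual.eval_apply, coneD_fst,
    coneD_snd, dualPairing_transposeMap q _ _ rfl, dualPairing_transposeMap q _ _ rfl]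
  simp only [map_add, hs, map_neg, add_zero, LinearMap.neg_apply, neg_neg]
  abel

end

section

variable {R : Type} [CommRing R] {M : Type} [AddCommGroup M] [Module R M]
  (P : ProjectiveResolution (ModuleCat.of R M))

theorem subsingleton_cochainComplex_X (i : ℤ) (hi : 0 < i) : Subsingleton (P.cochainComplex.X i) :=
  ModuleCat.subsingleton_of_isZero (P.cochainComplex.isZero_of_isStrictlyLE 0 i hi)

theorem finite_cochainComplex_X (hP : ∀ n, Module.Finite R (P.complex.X n)) (i : ℤ) :
    Module.Finite R (P.cochainComplex.X i) := by
  rcases lt_or_ge 0 i with hi | hi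
  · have := subsingleton_cochainComplex_X P i hi
    infer_instance
  · obtain ⟨k, rfl⟩ := Int.exists_eq_neg_ofNat hi
    have := hP k
    exact Module.Finite.equiv (P.cochainComplexXIso (-k) k).toLinearEquiv.symm

theorem projective_cochainComplex_X (i : ℤ) : Module.Projective R (P.cochainComplex.X i) := by
  rcases lt_or_ge 0 i with hi | hi
  · have := subsingleton_cochainComplex_X P i hi
    infer_instance
  · obtain ⟨k, rfl⟩ := Int.exists_eq_neg_ofNat hi
    have : Module.Projective R (P.complex.X k) :=
      (IsProjective.iff_projective _).2 (P.projective k)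
    exact Module.Projective.of_equiv (P.cochainComplexXIso (-k) k).toLinearEquiv.symm

theorem exact_cochainComplex_d {i j k : ℤ} (hij : i + 1 = j) (hjk : j + 1 = k) (hj : j < 0) :
    Function.Exact (P.cochainComplex.d i j).hom (P.cochainComplex.d j k).hom := by
  have h := P.cochainComplex.exactAt_of_isGE 0 j hj
  rw [HomologicalComplex.exactAt_iff' _ i j k (by simp; lia) (by simp; lia)] at h
  exact (ShortComplex.ShortExact.moduleCat_exact_iff_function_exact _).1 h

theorem nonempty_cochainComplex_quotient_equiv :
    Nonempty ((P.cochainComplex.X 0 ⧸ LinearMap.range (P.cochainComplex.d (-1) 0).hom) ≃ₗ[R] M) := by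
  let e := P.cochainComplexXIso 0 0
  let ε : P.cochainComplex.X 0 →ₗ[R] M :=
    (show P.complex.X 0 →ₗ[R] M from (P.π.f 0).hom) ∘ₗ e.hom.hom
  have hε : Function.Surjective ε :=
    ((ModuleCat.epi_iff_surjective (P.π.f 0)).1 inferInstance).comp e.toLinearEquiv.surjective
  have hex := (ShortComplex.ShortExact.moduleCat_exact_iff_function_exact _).1 P.exact₀
  have hker : LinearMap.range (P.cochainComplex.d (-1) 0).hom = LinearMap.ker ε := by
    rw [P.cochainComplex_d (-1) 0 1 0]
    ext x
    refine ⟨?_, fun hx => ?_⟩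
    · rintro ⟨y, rfl⟩
      have h := hex.apply_apply_eq_zero ((P.cochainComplexXIso (-1) 1).hom y)
      exact (congrArg (P.π.f 0) (e.toLinearEquiv.apply_symm_apply _)).trans h
    · obtain ⟨y, hy⟩ := (hex (e.hom x)).1 hx
      refine ⟨(P.cochainComplexXIso (-1) 1).inv y, ?_⟩
      refine (congrArg (fun z => e.inv (P.complex.d 1 0 z))
        ((P.cochainComplexXIso (-1) 1).toLinearEquiv.apply_symm_apply y)).trans ?_
      exact (congrArg e.inv hy).trans (e.toLinearEquiv.symm_apply_apply x)
  exact ⟨Submodule.quotEquivOfEq _ _ hker ≪≫ₗ ε.quotKerEquivOfSurjective hε⟩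

/-- If `Ext(M, R)` is concentrated in a degree in which it is isomorphic to `M`, then a projective
resolution of `M` is quasi-isomorphic to its own shifted dual. -/
theorem exists_quasiIso_dualComplex {g : ℕ} (e : ExtMod R M R g ≃ₗ[R] M)
    (h : ∀ i ≠ g, Subsingleton (ExtMod R M R i)) :
    ∃ q : P.cochainComplex ⟶ dualComplex (-g) P.cochainComplex, QuasiIso q := by
  have := dualComplex_isStrictlyGE P (-g)
  have hex (i : ℤ) (hi : i ≠ 0) : (dualComplex (-g) P.cochainComplex).ExactAt i := by
    rcases lt_or_ge i (-g) with hlt | hge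
    · exact CochainComplex.exactAt_of_isGE _ (-g) i hlt
    · obtain ⟨k, hk⟩ := Int.le.dest hge
      obtain ⟨f⟩ := nonempty_homology_dualComplex_iso P (-g) k
      have := h k (by lia)
      rw [HomologicalComplex.exactAt_iff_isZero_homology, ← hk]
      exact (ModuleCat.isZero_of_subsingleton _).of_iso f
  have : (dualComplex (-g) P.cochainComplex).IsGE 0 :=
    (CochainComplex.isGE_iff _ _).2 fun i hi => hex i hi.ne
  have : (dualComplex (-g) P.cochainComplex).IsLE 0 :=
    (CochainComplex.isLE_iff _ _).2 fun i hi => hex i hi.ne'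
  obtain ⟨f⟩ := nonempty_homology_dualComplex_iso P (-g) g
  rw [neg_add_cancel] at f
  exact exists_quasiIso_of_homology_iso
    (isoOfQuasiIsoAt P.π' 0 ≪≫ HomologicalComplex.singleObjHomologySelfIso _ 0 _ ≪≫
      e.symm.toModuleIso ≪≫ f.symm)

end

section

variable {R : Type} [CommRing R] {A B C : Type} [AddCommGroup A] [Module R A]
  [AddCommGroup B] [Module R B] [AddCommGroup C] [Module R C] {a : A →ₗ[R] B} {b : B →ₗ[R] C}

theorem exists_injective_exact_mkQ_range (h : Function.Exact a b) :
    ∃ f : (B ⧸ LinearMap.range a) →ₗ[R] C, Function.Injective f ∧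
      Function.Exact f (LinearMap.range b).mkQ := by
  refine ⟨(LinearMap.range a).liftQ b (h.linearMap_ker_eq ▸ le_rfl), ?_, ?_⟩
  · rw [← LinearMap.ker_eq_bot, Submodule.ker_liftQ_eq_bot']
    exact h.linearMap_ker_eq.symm
  · rw [LinearMap.exact_iff, Submodule.ker_mkQ, Submodule.range_liftQ]

theorem ExtVanishes.quotient_range [Module.Projective R C] (h : Function.Exact a b) {i : ℕ}
    (hi : 0 < i) (hb : ExtVanishes R (i + 1) (C ⧸ LinearMap.range b)) :
    ExtVanishes R i (B ⧸ LinearMap.range a) := by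
  obtain ⟨f, hf, hfg⟩ := exists_injective_exact_mkQ_range h
  exact ExtVanishes.left_of_exact hf hfg (Submodule.mkQ_surjective _)
    (extVanishes_of_projective hi) hb

theorem GdimLE.quotient_range [Module.Finite R C] [Module.Projective R C]
    (h : Function.Exact a b) {n : ℕ} (ha : GdimLE R n (ModuleCat.of R (B ⧸ LinearMap.range a))) :
    GdimLE R (n + 1) (ModuleCat.of R (C ⧸ LinearMap.range b)) := by
  obtain ⟨f, hf, hfg⟩ := exists_injective_exact_mkQ_range h
  refine Or.inr ⟨ModuleCat.of R C, (LinearMap.range b).mkQ, isTotallyReflexive_of_projective,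
    Submodule.mkQ_surjective _, ha.of_iso ?_⟩
  exact LinearEquiv.ofInjective f hf ≪≫ₗ
    LinearEquiv.ofEq _ _ (LinearMap.exact_iff.1 hfg).symm

end

section

variable {R : Type} [CommRing R] {c : ℤ} {L : CochainComplex (ModuleCat.{0} R) ℤ}

theorem nonempty_quotient_equiv_dual_range_coneD [∀ i, Module.Finite R (L.X i)]
    [∀ i, Module.Projective R (L.X i)] (q : L ⟶ dualComplex c L) [QuasiIso q]
    [QuasiIso (transposeMap q)] {n i j : ℤ} (hL : ∀ i, n + 1 < i → Subsingleton (L.X i))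
    (hi : i = c - (n + 1 + 1)) (hj : j = c - (n + 1)) :
    Nonempty ((L.X j ⧸ LinearMap.range (L.d i j).hom) ≃ₗ[R]
      Module.Dual R (LinearMap.range (coneD q n))) := by
  subst hi hj
  have h₁ := hL (n + 1 + 1) (by lia)
  have h₂ := hL (n + 1 + 1 + 1) (by lia)
  let φ : L.X (c - (n + 1)) →ₗ[R] Module.Dual R (LinearMap.range (coneD q n)) :=
    (LinearMap.snd R _ _ ∘ₗ (LinearMap.range (coneD q n)).subtype).flip
  have hφ (p) (z : LinearMap.range (coneD q n)) : φ p z = z.1.2 p := rfl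
  have hφs : Function.Surjective φ := by
    intro ξ
    obtain ⟨v, rfl⟩ := exists_extend_of_dual_exact (exact_coneD q) (exists_eq_comp_coneD q) n ξ
    obtain ⟨p, hp⟩ := (Module.bijective_dual_eval R (L.X (c - (n + 1)))).2
      (v ∘ₗ LinearMap.inr R _ _)
    refine ⟨p, LinearMap.ext fun z => ?_⟩
    have h : z.1.2 p = v (0, z.1.2) := congr($hp z.1.2)
    rw [hφ, h]
    exact congrArg v (Prod.ext (Subsingleton.elim _ _) rfl)
  have hker : LinearMap.range (L.d (c - (n + 1 + 1)) (c - (n + 1))).hom = LinearMap.ker φ := by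
    ext p
    constructor
    · rintro ⟨y, rfl⟩
      refine LinearMap.ext fun z => ?_
      have h : coneD q (n + 1) z.1 = 0 := (exact_coneD q n z.1).2 z.2
      have h' : (coneD q (n + 1) z.1).2 y = 0 := by rw [h]; rfl
      rw [coneD_snd, Subsingleton.elim z.1.1 0, map_zero, LinearMap.zero_apply, zero_add] at h'
      exact h'
    · intro hp
      obtain ⟨v, hv⟩ := exists_eq_comp_coneD q n (Module.Dual.eval R _ p ∘ₗ LinearMap.snd R _ _)
        (LinearMap.ext fun x => congr($hp ⟨coneD q n x, x, rfl⟩))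
      obtain ⟨r, hr⟩ := (Module.bijective_dual_eval R (L.X (c - (n + 1 + 1)))).2
        (v ∘ₗ LinearMap.inr R _ _)
      refine ⟨r, ?_⟩
      refine (sub_eq_zero.1 <| (Module.forall_dual_apply_eq_zero_iff R _).1 fun f => ?_)
      rw [map_sub, sub_eq_zero]
      have h₃ : f p = v (coneD q (n + 1) (0, f)) := congr($hv (0, f))
      have h₄ : f (L.d (c - (n + 1 + 1)) (c - (n + 1)) r) =
        v (0, f ∘ₗ (L.d (c - (n + 1 + 1)) (c - (n + 1))).hom) :=
          congr($hr (f ∘ₗ (L.d (c - (n + 1 + 1)) (c - (n + 1))).hom))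
      refine h₄.trans (Eq.trans (congrArg v (Prod.ext (Subsingleton.elim _ _) ?_)) h₃.symm)
      refine LinearMap.ext fun y => ?_
      rw [coneD_snd, map_zero, LinearMap.zero_apply, zero_add]
      rfl
  exact ⟨Submodule.quotEquivOfEq _ _ hker ≪≫ₗ φ.quotKerEquivOfSurjective hφs⟩

end

section

variable {R : Type} [CommRing R] {M : Type} [AddCommGroup M] [Module R M]
  (P : ProjectiveResolution (ModuleCat.of R M))

theorem extVanishes_syzygy {i k : ℕ} (hi : 0 < i) (h : ExtVanishes R (i + k) M) {m n : ℤ}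
    (hm : m = -k - 1) (hn : n = -k) :
    ExtVanishes R i
      (P.cochainComplex.X n ⧸ LinearMap.range (P.cochainComplex.d m n).hom) := by
  induction k generalizing i m n with
  | zero =>
    obtain rfl : m = -1 := by lia
    obtain rfl : n = 0 := by lia
    obtain ⟨e⟩ := nonempty_cochainComplex_quotient_equiv P
    exact h.of_equiv e.symm
  | succ k ih =>
    have := projective_cochainComplex_X P (n + 1)
    exact ExtVanishes.quotient_range (exact_cochainComplex_d P (by lia) rfl (by lia)) hi
      (ih (by lia) (by convert h using 1; lia) (by lia) (by lia))

theorem gdimLE_of_isTotallyReflexive_syzygy (hP : ∀ n, Module.Finite R (P.complex.X n)) {k : ℕ}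
    {m n : ℤ} (hm : m = -k - 1) (hn : n = -k)
    (h : IsTotallyReflexive R
      (P.cochainComplex.X n ⧸ LinearMap.range (P.cochainComplex.d m n).hom)) :
    GdimLE R k (ModuleCat.of R M) := by
  have key (l : ℕ) (hl : l ≤ k) (m' n' : ℤ) (hm' : m' = l - k - 1)
      (hn' : n' = l - k) : GdimLE R l (ModuleCat.of R
        (P.cochainComplex.X n' ⧸ LinearMap.range (P.cochainComplex.d m' n').hom)) := by
    induction l generalizing m' n' with
    | zero =>
      obtain rfl : m' = m := by lia
      obtain rfl : n' = n := by lia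
      exact h
    | succ l ih =>
      have := projective_cochainComplex_X P n'
      have := finite_cochainComplex_X P hP n'
      exact GdimLE.quotient_range (exact_cochainComplex_d P (i := m' - 1) (by lia) (by lia) (by lia))
        (ih (by lia) _ _ (by lia) (by lia))
  obtain ⟨e⟩ := nonempty_cochainComplex_quotient_equiv P
  exact (key k le_rfl (-1) 0 (by lia) (by lia)).of_iso e

end

theorem gdimLE_of_extMod_equiv {R : Type} [CommRing R] [IsNoetherianRing R] {M : Type}
    [AddCommGroup M] [Module R M] [Module.Finite R M] {g : ℕ} (e : ExtMod R M R g ≃ₗ[R] M)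
    (h : ∀ i ≠ g, Subsingleton (ExtMod R M R i)) : GdimLE R g (ModuleCat.of R M) := by
  obtain ⟨P, hP⟩ := exists_finite_projectiveResolution R M
  obtain ⟨q, hq⟩ := exists_quasiIso_dualComplex P e h
  have := finite_cochainComplex_X P hP
  have := projective_cochainComplex_X P
  have hq' := quasiIso_transposeMap q
  obtain ⟨f⟩ := nonempty_quotient_equiv_dual_range_coneD q (n := -1)
    (fun i hi => subsingleton_cochainComplex_X P i (by lia)) rfl rfl
  have hZ : IsTotallyReflexive R (Module.Dual R (LinearMap.range (coneD q (-1)))) := by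
    refine isTotallyReflexive_dual_of_extVanishes (A := LinearMap.range (coneD q (-1)))
      (bijective_dual_eval_range (exact_coneD q) (exists_eq_comp_coneD q) (-1)) ?_ ?_
    · intro i hi
      obtain ⟨i, rfl⟩ := Nat.exists_eq_succ_of_ne_zero hi.ne'
      exact extVanishes_range (exact_coneD q) (exists_eq_comp_coneD q) (-1) i
    · intro i hi
      exact (extVanishes_syzygy P hi ((subsingleton_extMod_iff_extVanishes R M _ (by lia)).1
        (h (i + g) (by lia))) (by lia) (by lia)).of_equiv f
  exact gdimLE_of_isTotallyReflexive_syzygy P hP (by lia) (by lia) (hZ.of_equiv f.symm)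

/-- A nonzero finitely generated module `M` of grade `g` is totally self-dual iff
it is G-perfect and `Ext^g_R(M,R) ≅ M`. -/
theorem stmt_10 (R : Type) [CommRing R] [IsNoetherianRing R]
    (M : Type) [AddCommGroup M] [Module R M] [Module.Finite R M] [Nontrivial M]
    (g : ℕ) (hg : mgrade R M = g) :
    IsTotallySelfDual R M ↔
      (IsGPerfect R M ∧ Nonempty (ExtMod R M R g ≃ₗ[R] M)) := by
  subst hg
  constructor
  · rintro ⟨-, ⟨e⟩, h⟩
    refine ⟨⟨inferInstance, le_antisymm
      (sInf_le ⟨_, rfl, gdimLE_of_extMod_equiv e h⟩) (le_sInf ?_)⟩, ⟨e⟩⟩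
    rintro _ ⟨m, rfl, hm⟩
    by_contra! hlt
    rw [Nat.cast_lt] at hlt
    have := (subsingleton_extMod_iff_extVanishes R M _ (by lia)).2 (hm.extVanishes hlt)
    exact not_subsingleton M e.symm.injective.subsingleton
  · rintro ⟨⟨-, hG⟩, ⟨e⟩⟩
    refine ⟨inferInstance, ⟨e⟩, fun i hi => ?_⟩
    rcases hi.lt_or_gt with hlt | hgt
    · exact not_nontrivial_iff_subsingleton.1 (Nat.notMem_of_lt_sInf hlt)
    · have hne : {n : ℕ∞ | ∃ m : ℕ, n = (m : ℕ∞) ∧ GdimLE R m (ModuleCat.of R M)}.Nonempty := by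
        rw [Set.nonempty_iff_ne_empty]
        intro h
        rw [Gdim, h, sInf_empty] at hG
        exact ENat.top_ne_natCast _ hG
      obtain ⟨m, hm, hM⟩ := csInf_mem hne
      obtain rfl : mgrade R M = m := by
        exact_mod_cast hG.symm.trans hm
      exact (subsingleton_extMod_iff_extVanishes R M i (by lia)).2 (hM.extVanishes hgt)
end
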